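/- Let C be the (α + uβ)-constacyclic code of length np^s over R given by the ideal C = Σ_{j=1}^r ε_j·⟨f_j(x)^{i_j}⟩ (mod x^{np^s} − α − uβ) of 𝓡, with 0 ≤ i_j ≤ 2p^s, viewed as a code in R^{np^s} via coefficient vectors of representatives of degree < np^s. Then its dual code C^⊥ is the (α + uβ)^{-1}-constacyclic code of length np^s over R given by the ideal Σ_{j=1}^r ε̂_j·⟨f_j(x^{-1})^{2p^s − i_j}⟩ (mod x^{np^s} − (α + uβ)^{-1}) of 𝓡̂ = R[x]/⟨x^{np^s} − (α + uβ)^{-1}⟩, where x^{-1} = (α + uβ)x^{np^s−1} in 𝓡̂, f_j(x^{-1}) denotes f_j evaluated at this element, and ε̂_j = τ(ε_j) is the image of ε_j under the substitution x ↦ x^{-1}. -/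

import Mathlib

open Polynomial

/-- `α + uβ` as an element of `R = F + uF = DualNumber F`
(where `u = DualNumber.eps` satisfies `u² = 0`). -/
noncomputable def lamAdd (F : Type) [Field F] (α β : F) : DualNumber F :=
  algebraMap F (DualNumber F) α + DualNumber.eps * algebraMap F (DualNumber F) β

/-- The ambient ring `R[x]/⟨x^N − l⟩`, realized as `AdjoinRoot (X^N - C l)`,
which is by definition the quotient ring `R[x] ⧸ ⟨X^N - C l⟩`. -/
noncomputable abbrev Amb (F : Type) [Field F] (N : ℕ) (l : DualNumber F) : Type :=
  AdjoinRoot ((X : (DualNumber F)[X]) ^ N - C l)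

/-- The natural projection `R[x] → R[x]/⟨x^N − l⟩`. -/
noncomputable abbrev ambMk (F : Type) [Field F] (N : ℕ) (l : DualNumber F) :
    (DualNumber F)[X] →+* Amb F N l :=
  AdjoinRoot.mk _

/-- The polynomial `∑ c_i x^i` associated with a vector `c ∈ R^N`. -/
noncomputable def toPoly {A : Type} [CommRing A] {N : ℕ} (c : Fin N → A) : A[X] :=
  ∑ i, Polynomial.C (c i) * X ^ (i : ℕ)

/-- The code in `R^N` corresponding to an ideal `I` of `R[x]/⟨x^N − l⟩`: the set of
coefficient vectors `c ∈ R^N` (coefficients of the unique representative of degree `< N`)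
whose associated polynomial class lies in `I`. -/
noncomputable def codeOf (F : Type) [Field F] (N : ℕ) (l : DualNumber F)
    (I : Ideal (Amb F N l)) : Set (Fin N → DualNumber F) :=
  {c | ambMk F N l (toPoly c) ∈ I}

/-- The dual code `C^⊥ = {a ∈ R^N | a·b = 0 for all b ∈ C}`, where `a·b = ∑ aᵢbᵢ`. -/
def dualCode {A : Type} [CommRing A] {N : ℕ} (S : Set (Fin N → A)) : Set (Fin N → A) :=
  {a | ∀ b ∈ S, ∑ i, a i * b i = 0}

/-- `(α + uβ)⁻¹ = α⁻¹ − u α⁻² β` as an element of `R = F + uF = DualNumber F`. -/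
noncomputable def lamInv (F : Type) [Field F] (α β : F) : DualNumber F :=
  algebraMap F (DualNumber F) α⁻¹ - DualNumber.eps * algebraMap F (DualNumber F) (α⁻¹ ^ 2 * β)

namespace DualNumber

variable {F : Type} [Field F]

/-- The reduction `(F + uF)[x] → F[x]` modulo `u`. -/
noncomputable def polyFst (F : Type) [Field F] : (DualNumber F)[X] →+* F[X] :=
  mapRingHom (TrivSqZeroExt.fstHom F F F).toRingHom

theorem coeff_polyFst (p : (DualNumber F)[X]) (k : ℕ) :
    (polyFst F p).coeff k = (p.coeff k).fst :=
  coeff_map _ k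

theorem polyFst_map (p : F[X]) : polyFst F (p.map (algebraMap F (DualNumber F))) = p := by
  ext k
  simp [coeff_polyFst, TrivSqZeroExt.algebraMap_eq_inl]

theorem polyFst_C_eps : polyFst F (C eps) = 0 := by
  ext k
  by_cases hk : k = 0 <;> simp [coeff_polyFst, coeff_C, hk]

theorem C_eps_mul_C_eps : (C eps * C eps : (DualNumber F)[X]) = 0 := by
  rw [← C_mul, eps_mul_eps, C_0]

theorem polyFst_eq_zero_of_C_eps_mul {p : (DualNumber F)[X]} (hp : C eps * p = 0) :
    polyFst F p = 0 := by
  ext k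
  have h := congrArg (fun q => (coeff q k).snd) hp
  simpa [coeff_polyFst] using h

theorem exists_of_polyFst_eq_zero {p : (DualNumber F)[X]} (hp : polyFst F p = 0) :
    ∃ q : F[X], p = C eps * q.map (algebraMap F (DualNumber F)) := by
  have hc : ∀ k, (p.coeff k).fst = 0 := fun k => by
    simpa [coeff_polyFst] using congrArg (fun q => coeff q k) hp
  refine ⟨∑ k ∈ p.support, monomial k (p.coeff k).snd, ?_⟩
  ext k
  · simp [hc]
  · simp only [coeff_C_mul, coeff_map, finsetSum_coeff, coeff_monomial]
    by_cases hk : p.coeff k = 0 <;> simp [TrivSqZeroExt.algebraMap_eq_inl, hk]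

theorem exists_eq_map_add_C_eps_mul (p : (DualNumber F)[X]) :
    ∃ q : F[X], p = (polyFst F p).map (algebraMap F (DualNumber F)) +
      C eps * q.map (algebraMap F (DualNumber F)) := by
  obtain ⟨q, hq⟩ := exists_of_polyFst_eq_zero
    (p := p - (polyFst F p).map (algebraMap F (DualNumber F))) (by simp [polyFst_map])
  exact ⟨q, by rw [← hq]; ring⟩

/-- Modulo `f ^ (k + 1) + u g` with `f`, `g` coprime, the annihilator of `f` is generated by
`f ^ (2 * k + 1)`. -/
theorem exists_dvd_sub_of_dvd_mul {f g : F[X]} (hf : f ≠ 0) (hfg : IsCoprime f g) (k : ℕ)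
    {a : (DualNumber F)[X]}
    (ha : (f.map (algebraMap F (DualNumber F))) ^ (k + 1) +
      C eps * g.map (algebraMap F (DualNumber F)) ∣ a * f.map (algebraMap F (DualNumber F))) :
    ∃ c, (f.map (algebraMap F (DualNumber F))) ^ (k + 1) +
      C eps * g.map (algebraMap F (DualNumber F)) ∣
        a - c * (f.map (algebraMap F (DualNumber F))) ^ (2 * k + 1) := by
  obtain ⟨q, hq⟩ := ha
  have h₁ := congrArg (polyFst F) hq
  simp only [map_mul, map_add, map_pow, polyFst_map, polyFst_C_eps, zero_mul, add_zero] at h₁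
  have h₂ : polyFst F a = polyFst F q * f ^ k := mul_right_cancel₀ hf (by rw [h₁]; ring)
  obtain ⟨b, hb⟩ := exists_of_polyFst_eq_zero
    (p := a - q * (f.map (algebraMap F (DualNumber F))) ^ k) (by simp [polyFst_map, h₂])
  have h₃ := polyFst_eq_zero_of_C_eps_mul
    (p := b.map (algebraMap F (DualNumber F)) * f.map (algebraMap F (DualNumber F)) -
      q * g.map (algebraMap F (DualNumber F))) (by
    linear_combination hq - f.map (algebraMap F (DualNumber F)) * hb)
  simp only [map_mul, map_sub, polyFst_map, sub_eq_zero] at h₃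
  obtain ⟨q', hq'⟩ : f ∣ polyFst F q := hfg.dvd_of_dvd_mul_right (h₃ ▸ dvd_mul_left f b)
  have hb' : b = q' * g := mul_right_cancel₀ hf (by rw [h₃, hq']; ring)
  obtain ⟨e, he⟩ := exists_eq_map_add_C_eps_mul q
  obtain ⟨d, c, hdc⟩ := hfg.pow_left (m := k + 1)
  have hdc' := congrArg (Polynomial.map (algebraMap F (DualNumber F))) hdc
  rw [hq'] at he
  rw [hb'] at hb
  simp only [Polynomial.map_mul, Polynomial.map_add, Polynomial.map_pow,
    Polynomial.map_one] at hb he hdc'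
  generalize f.map (algebraMap F (DualNumber F)) = f at *
  generalize g.map (algebraMap F (DualNumber F)) = g at *
  generalize q'.map (algebraMap F (DualNumber F)) = q' at *
  generalize e.map (algebraMap F (DualNumber F)) = e at *
  generalize d.map (algebraMap F (DualNumber F)) = d at *
  generalize c.map (algebraMap F (DualNumber F)) = c at *
  refine ⟨(C eps * d - c) * e, q' + f ^ k * c * e, ?_⟩
  linear_combination hb + f ^ k * he - C eps * e * f ^ k * hdc'

/-- Modulo `f ^ (k + 1) + u g` with `f`, `g` coprime, the annihilator of `f ^ i` is generated by
`f ^ (2 * (k + 1) - i)`. -/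
theorem exists_dvd_sub_of_dvd_mul_pow {f g : F[X]} (hf : f ≠ 0) (hfg : IsCoprime f g) (k : ℕ)
    {i : ℕ} (hi : i ≤ 2 * (k + 1)) {a : (DualNumber F)[X]}
    (ha : (f.map (algebraMap F (DualNumber F))) ^ (k + 1) +
      C eps * g.map (algebraMap F (DualNumber F)) ∣
        a * (f.map (algebraMap F (DualNumber F))) ^ i) :
    ∃ c, (f.map (algebraMap F (DualNumber F))) ^ (k + 1) +
      C eps * g.map (algebraMap F (DualNumber F)) ∣
        a - c * (f.map (algebraMap F (DualNumber F))) ^ (2 * (k + 1) - i) := by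
  induction i generalizing a with
  | zero => exact ⟨0, by simpa using ha⟩
  | succ i ih =>
    obtain ⟨c, hc⟩ := ih (by omega) (a := a * f.map (algebraMap F (DualNumber F)))
      (by rwa [mul_assoc, ← pow_succ'])
    obtain ⟨j, hj⟩ : ∃ j, 2 * (k + 1) - i = j + 1 := ⟨2 * (k + 1) - i - 1, by omega⟩
    obtain ⟨d, hd⟩ := exists_dvd_sub_of_dvd_mul hf hfg k
      (a := a - c * (f.map (algebraMap F (DualNumber F))) ^ j) (by
        rw [hj] at hc
        convert hc using 1
        ring)
    refine ⟨c + d * (f.map (algebraMap F (DualNumber F))) ^ i, ?_⟩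
    convert hd using 1
    rw [show 2 * (k + 1) - (i + 1) = j by omega, show 2 * k + 1 = i + j by omega]
    ring

/-- `f ^ k + u g` divides `f ^ (2 * k)`. -/
theorem dvd_pow_two_mul (f g : (DualNumber F)[X]) (k : ℕ) :
    f ^ k + C eps * g ∣ f ^ (2 * k) := by
  refine ⟨f ^ k - C eps * g, ?_⟩
  linear_combination g ^ 2 * C_eps_mul_C_eps (F := F)

/-- If `f ^ P + u g` divides `x ^ (n * P) - (α + uβ)` with `β ≠ 0`, then an irreducible factor
`f` of `x ^ n - α₀`, where `α₀ ^ P = α`, is coprime to `g`. -/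
theorem isCoprime_of_dvd {n P : ℕ} (hP : P ≠ 0) {α β α₀ : F} (hβ : β ≠ 0) (hα₀ : α₀ ^ P = α)
    {f g : F[X]} (hf : Irreducible f) (hfn : f ∣ X ^ n - C α₀)
    (hdvd : (f.map (algebraMap F (DualNumber F))) ^ P +
      C eps * g.map (algebraMap F (DualNumber F)) ∣ X ^ (n * P) - C (lamAdd F α β)) :
    IsCoprime f g := by
  refine hf.coprime_iff_not_dvd.2 fun hg => hf.not_isUnit ?_
  have h₁ : f.map (algebraMap F (DualNumber F)) ∣ X ^ (n * P) - C (lamAdd F α β) :=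
    (dvd_add (dvd_pow_self _ hP) ((Polynomial.map_dvd (algebraMap F (DualNumber F)) hg).trans
      ⟨C eps, by ring⟩)).trans hdvd
  have h₂ : f.map (algebraMap F (DualNumber F)) ∣ X ^ (n * P) - C (algebraMap F _ α) := by
    have := Polynomial.map_dvd (algebraMap F (DualNumber F))
      (hfn.trans (sub_dvd_pow_sub_pow (X ^ n) (C α₀) P))
    simpa [← pow_mul, ← hα₀] using this
  obtain ⟨b, hb⟩ := (dvd_sub h₂ h₁).mul_right (C (algebraMap F (DualNumber F) β⁻¹))
  have hb' : C eps = f.map (algebraMap F (DualNumber F)) * b := by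
    rw [← hb, lamAdd, sub_sub_sub_cancel_left, ← C_sub, ← C_mul, add_sub_cancel_left, mul_assoc,
      ← map_mul, mul_inv_cancel₀ hβ, map_one, mul_one]
  have h₃ := congrArg (polyFst F) hb'
  rw [polyFst_C_eps, map_mul, polyFst_map, eq_comm, mul_eq_zero, or_iff_right hf.ne_zero] at h₃
  obtain ⟨d, rfl⟩ := exists_of_polyFst_eq_zero h₃
  have h₄ := polyFst_eq_zero_of_C_eps_mul
    (p := 1 - f.map (algebraMap F (DualNumber F)) * d.map (algebraMap F (DualNumber F)))
    (by linear_combination hb')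
  simp only [map_sub, map_one, map_mul, polyFst_map, sub_eq_zero] at h₄
  exact IsUnit.of_mul_eq_one d h₄.symm

end DualNumber

section Annihilator

variable {B : Type*} [CommRing B] {ι : Type*} [Fintype ι]

theorem Ideal.mem_sum_span_singleton {d : ι → B} {x : B} :
    x ∈ ∑ j, Ideal.span {d j} ↔ ∃ c : ι → B, ∑ j, c j * d j = x := by
  rw [Ideal.sum_eq_sup, Finset.sup_univ_eq_iSup, ← Ideal.span_range_eq_iSup,
    Ideal.mem_span_range_iff_exists_fun]

/-- The annihilator of an ideal split along a complete family of orthogonal elements, when the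
annihilators of the components are known. -/
theorem forall_mul_eq_zero_iff_exists_sum {e d d' : ι → B} (hsum : ∑ j, e j = 1)
    (hort : ∀ j l, j ≠ l → e j * e l = 0) (hdd : ∀ j, e j * (d j * d' j) = 0)
    (hann : ∀ j z, z * (e j * d j) = 0 → ∃ c, e j * z = c * (e j * d' j)) (z : B) :
    (∀ j, z * (e j * d j) = 0) ↔ ∃ c : ι → B, ∑ j, c j * (e j * d' j) = z := by
  constructor
  · intro hz
    choose c hc using fun j => hann j z (hz j)
    exact ⟨c, by rw [← Finset.sum_congr rfl fun j _ => hc j, ← Finset.sum_mul, hsum, one_mul]⟩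
  · rintro ⟨c, rfl⟩ j
    rw [Finset.sum_mul]
    refine Finset.sum_eq_zero fun l _ => ?_
    by_cases hjl : j = l
    · subst hjl
      linear_combination c j * e j * hdd j
    · linear_combination c l * d' l * d j * hort j l hjl

end Annihilator

section Idempotents

variable {A : Type*} [CommRing A] {ι : Type*} [Fintype ι] [DecidableEq ι] {h s t : ι → A}

theorem prod_dvd_erase_mul_erase {j l : ι} (hjl : j ≠ l) :
    ∏ i, h i ∣ (s j * ∏ i ∈ Finset.univ.erase j, h i) *
      (s l * ∏ i ∈ Finset.univ.erase l, h i) := by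
  have h₁ : h l ∣ ∏ i ∈ Finset.univ.erase j, h i :=
    Finset.dvd_prod_of_mem h (by simp [hjl.symm])
  rw [← Finset.mul_prod_erase Finset.univ h (Finset.mem_univ l)]
  exact mul_dvd_mul (h₁.mul_left _) (dvd_mul_left _ _)

theorem prod_dvd_sum_erase_sub_one (hcop : ∀ j l, j ≠ l → IsCoprime (h j) (h l))
    (hst : ∀ j, s j * ∏ l ∈ Finset.univ.erase j, h l + t j * h j = 1) :
    ∏ i, h i ∣ ∑ j, s j * ∏ l ∈ Finset.univ.erase j, h l - 1 := by
  refine Finset.prod_dvd_of_coprime (fun j _ l _ hjl => hcop j l hjl) fun k _ => ?_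
  rw [← Finset.add_sum_erase _ _ (Finset.mem_univ k), add_sub_right_comm]
  refine dvd_add ⟨-t k, by linear_combination hst k⟩ (Finset.dvd_sum fun j hj => ?_)
  exact (Finset.dvd_prod_of_mem h (by simpa using (Finset.ne_of_mem_erase hj).symm)).mul_left _

end Idempotents

section Constacyclic

variable {A : Type} [CommRing A] {N : ℕ} {l l' : A}

theorem mk_X_mul_inv (hN : N ≠ 0) (hl : l * l' = 1) :
    AdjoinRoot.mk (X ^ N - C l') X * AdjoinRoot.mk (X ^ N - C l') (C l * X ^ (N - 1)) = 1 := by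
  rw [← map_mul, ← map_one (AdjoinRoot.mk (X ^ N - C l')), AdjoinRoot.mk_eq_mk]
  refine ⟨C l, ?_⟩
  have hc : (C l * C l' : A[X]) = 1 := by rw [← C_mul, hl, C_1]
  linear_combination hc + C l * mul_pow_sub_one hN (X : A[X])

theorem mk_inv_pow (hN : N ≠ 0) (hl : l * l' = 1) :
    AdjoinRoot.mk (X ^ N - C l') (C l * X ^ (N - 1)) ^ N = algebraMap A _ l := by
  have h₁ := congrArg (· ^ N) (mk_X_mul_inv hN hl)
  have h₂ : AdjoinRoot.mk (X ^ N - C l') X ^ N = AdjoinRoot.mk (X ^ N - C l') (C l') := by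
    rw [← map_pow, AdjoinRoot.mk_eq_mk]
  have hc : AdjoinRoot.mk (X ^ N - C l') (C l) * AdjoinRoot.mk (X ^ N - C l') (C l') = 1 := by
    rw [← map_mul, ← C_mul, hl, C_1, map_one]
  simp only [mul_pow, one_pow, h₂] at h₁
  rw [AdjoinRoot.algebraMap_eq, ← AdjoinRoot.mk_C]
  linear_combination AdjoinRoot.mk (X ^ N - C l') (C l) * h₁ -
    AdjoinRoot.mk (X ^ N - C l') (C l * X ^ (N - 1)) ^ N * hc

/-- The substitution `x ↦ x⁻¹` from `A[x]/(x ^ N - l)` to `A[x]/(x ^ N - l')`, for `l l' = 1`. -/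
noncomputable def inversion (hN : N ≠ 0) (hl : l * l' = 1) :
    AdjoinRoot ((X : A[X]) ^ N - C l) →ₐ[A] AdjoinRoot ((X : A[X]) ^ N - C l') :=
  AdjoinRoot.liftAlgHom _ (Algebra.ofId A _)
    (AdjoinRoot.mk (X ^ N - C l') (C l * X ^ (N - 1))) <| by
      simpa [Algebra.ofId_apply, sub_eq_zero] using mk_inv_pow hN hl

theorem inversion_mk (hN : N ≠ 0) (hl : l * l' = 1) (p : A[X]) :
    inversion hN hl (AdjoinRoot.mk _ p) =
      aeval (AdjoinRoot.mk (X ^ N - C l') (C l * X ^ (N - 1))) p :=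
  rfl

theorem inversion_mk_X_mul (hN : N ≠ 0) (hl : l * l' = 1) :
    inversion hN hl (AdjoinRoot.mk _ X) * AdjoinRoot.mk _ X = 1 := by
  rw [inversion_mk, aeval_X, mul_comm, mk_X_mul_inv hN hl]

theorem inversion_comp_inversion (hN : N ≠ 0) (hl : l * l' = 1) (hl' : l' * l = 1) :
    (inversion hN hl).comp (inversion hN hl') = AlgHom.id A _ := by
  refine AdjoinRoot.algHom_ext ?_
  rw [AlgHom.comp_apply, AlgHom.id_apply, ← AdjoinRoot.mk_X]
  have h := congrArg (inversion hN hl) (inversion_mk_X_mul hN hl')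
  rw [map_mul, map_one] at h
  refine (left_inv_eq_right_inv h ?_).trans rfl
  exact inversion_mk_X_mul hN hl

theorem inversion_inversion (hN : N ≠ 0) (hl : l * l' = 1) (hl' : l' * l = 1)
    (z : AdjoinRoot ((X : A[X]) ^ N - C l')) :
    inversion hN hl (inversion hN hl' z) = z :=
  DFunLike.congr_fun (inversion_comp_inversion hN hl hl') z

theorem exists_mk_toPoly [Nontrivial A] (hN : N ≠ 0) (z : AdjoinRoot ((X : A[X]) ^ N - C l)) :
    ∃ c : Fin N → A, AdjoinRoot.mk _ (toPoly c) = z := by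
  have hm : ((X : A[X]) ^ N - C l).Monic := monic_X_pow_sub_C l hN
  obtain ⟨p, rfl⟩ := AdjoinRoot.mk_surjective z
  have hdeg : (p %ₘ (X ^ N - C l)).natDegree < N := by
    simpa using natDegree_modByMonic_lt p hm
      fun h => hN (by simpa using congrArg natDegree h)
  refine ⟨fun i => (p %ₘ (X ^ N - C l)).coeff i, ?_⟩
  rw [toPoly, Fin.sum_univ_eq_sum_range (fun i => C ((p %ₘ (X ^ N - C l)).coeff i) * X ^ i)]
  simp only [C_mul_X_pow_eq_monomial]
  rw [← as_sum_range' _ _ hdeg, AdjoinRoot.mk_eq_mk, modByMonic_eq_sub_mul_div]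
  exact ⟨-(p /ₘ (X ^ N - C l)), by ring⟩

/-- The constant coefficient of the representative of degree `< N`. -/
noncomputable def constCoeff (hN : N ≠ 0) (l : A) :
    AdjoinRoot ((X : A[X]) ^ N - C l) →ₗ[A] A :=
  (lcoeff A 0).comp (AdjoinRoot.modByMonicHom (monic_X_pow_sub_C l hN))

theorem constCoeff_X_pow [Nontrivial A] (hN : N ≠ 0) {k : ℕ} (hk : k < N) :
    constCoeff hN l (AdjoinRoot.mk _ (X ^ k)) = if k = 0 then 1 else 0 := by
  have hm : ((X : A[X]) ^ N - C l).Monic := monic_X_pow_sub_C l hN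
  change (X ^ k %ₘ (X ^ N - C l)).coeff 0 = _
  rw [(modByMonic_eq_self_iff hm).2, coeff_X_pow]
  · simp only [eq_comm]
  · rw [degree_X_pow, degree_X_pow_sub_C (Nat.pos_of_ne_zero hN)]
    exact_mod_cast hk

theorem constCoeff_X_pow_mul_inversion [Nontrivial A] (hN : N ≠ 0) (hl : l * l' = 1)
    (i j : Fin N) :
    constCoeff hN l' (AdjoinRoot.mk _ (X ^ (i : ℕ)) *
      inversion hN hl (AdjoinRoot.mk _ (X ^ (j : ℕ)))) = if i = j then 1 else 0 := by
  have hxy : AdjoinRoot.mk (X ^ N - C l') X * inversion hN hl (AdjoinRoot.mk _ X) = 1 := by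
    rw [mul_comm, inversion_mk_X_mul]
  rw [map_pow, map_pow, map_pow]
  rcases le_or_gt (j : ℕ) i with hij | hij
  · obtain ⟨d, hd⟩ := Nat.exists_eq_add_of_le' hij
    rw [hd, pow_add, mul_assoc, ← mul_pow, hxy, one_pow, mul_one, ← map_pow,
      constCoeff_X_pow hN (by omega)]
    exact if_congr (by rw [Fin.ext_iff]; omega) rfl rfl
  · have hN' : inversion hN hl (AdjoinRoot.mk _ X) ^ N =
        algebraMap A (AdjoinRoot (X ^ N - C l')) l := by
      rw [inversion_mk, aeval_X, mk_inv_pow hN hl]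
    have key : AdjoinRoot.mk (X ^ N - C l') X ^ (i : ℕ) *
        inversion hN hl (AdjoinRoot.mk _ X) ^ (j : ℕ) =
        l • AdjoinRoot.mk (X ^ N - C l') (X ^ (N + i - j)) := by
      rw [Algebra.smul_def, ← hN', map_pow]
      generalize AdjoinRoot.mk (X ^ N - C l') X = x at *
      generalize inversion hN hl (AdjoinRoot.mk _ X) = y at *
      calc x ^ (i : ℕ) * y ^ (j : ℕ)
          = x ^ (i : ℕ) * y ^ (j : ℕ) * (x * y) ^ (N - j) := by rw [hxy, one_pow, mul_one]
        _ = y ^ (j + (N - j) : ℕ) * x ^ (i + (N - j) : ℕ) := by ring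
        _ = _ := by congr 2 <;> omega
    rw [key, map_smul, constCoeff_X_pow hN (by omega), if_neg (by omega),
      if_neg (by rw [Fin.ext_iff]; omega), smul_zero]

/-- The dot product of two vectors is the constant coefficient of `a(x) b(x⁻¹)`. -/
theorem constCoeff_toPoly_mul_inversion [Nontrivial A] (hN : N ≠ 0) (hl : l * l' = 1)
    (a b : Fin N → A) :
    constCoeff hN l' (AdjoinRoot.mk _ (toPoly a) *
      inversion hN hl (AdjoinRoot.mk _ (toPoly b))) = ∑ i, a i * b i := by
  have hs : ∀ (l : A) (c : Fin N → A), AdjoinRoot.mk (X ^ N - C l) (toPoly c) =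
      ∑ i, c i • AdjoinRoot.mk (X ^ N - C l) (X ^ (i : ℕ)) := fun l c => by
    simp [toPoly, Algebra.smul_def, AdjoinRoot.algebraMap_eq]
  rw [hs, hs]
  simp only [map_sum, map_smul, Finset.sum_mul_sum, smul_mul_smul_comm,
    constCoeff_X_pow_mul_inversion, smul_eq_mul, mul_ite, mul_one, mul_zero, Finset.sum_ite_eq,
    Finset.mem_univ, if_true]

theorem eq_zero_of_constCoeff [Nontrivial A] (hN : N ≠ 0) (hl : l * l' = 1)
    (w : AdjoinRoot ((X : A[X]) ^ N - C l'))
    (hw : ∀ z, constCoeff hN l' (w * inversion hN hl z) = 0) : w = 0 := by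
  obtain ⟨c, rfl⟩ := exists_mk_toPoly hN w
  have hc : c = 0 := by
    ext i
    simpa [constCoeff_toPoly_mul_inversion, Pi.single_apply] using
      hw (AdjoinRoot.mk _ (toPoly (Pi.single i 1)))
  simp [hc, toPoly]

theorem mem_dualCode_iff [Nontrivial A] (hN : N ≠ 0) (hl : l * l' = 1)
    (I : Ideal (AdjoinRoot ((X : A[X]) ^ N - C l))) (a : Fin N → A) :
    a ∈ dualCode {c : Fin N → A | AdjoinRoot.mk _ (toPoly c) ∈ I} ↔
      ∀ z ∈ I, AdjoinRoot.mk _ (toPoly a) * inversion hN hl z = 0 := by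
  constructor
  · intro ha z hz
    refine eq_zero_of_constCoeff hN hl _ fun z' => ?_
    obtain ⟨b, hb⟩ := exists_mk_toPoly hN (z * z')
    rw [mul_assoc, ← map_mul, ← hb, constCoeff_toPoly_mul_inversion]
    refine ha b ?_
    rw [Set.mem_ofPred_eq, hb]
    exact I.mul_mem_right _ hz
  · intro ha b hb
    rw [← constCoeff_toPoly_mul_inversion hN hl, ha _ hb, map_zero]

end Constacyclic

theorem lamAdd_mul_lamInv {F : Type} [Field F] {α : F} (β : F) (hα : α ≠ 0) :
    lamAdd F α β * lamInv F α β = 1 := by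
  ext
  · simp [lamAdd, lamInv, TrivSqZeroExt.algebraMap_eq_inl, hα]
  · simp [lamAdd, lamInv, TrivSqZeroExt.algebraMap_eq_inl]
    field_simp
    ring

/-- With the Chinese-remainder setup for
`x^{np^s} - α - uβ = ∏_j h_j`, `h_j = f_j^{p^s} + u g_j`, and idempotents `ε_j` of
`𝓡 = R[x]/⟨x^{np^s} - (α + uβ)⟩`: let `C` be the `(α + uβ)`-constacyclic code given by the
ideal `Σ_j ε_j·⟨f_j(x)^{i_j}⟩` of `𝓡` with `0 ≤ i_j ≤ 2p^s`, viewed in `R^{np^s}` via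
coefficient vectors. Then its dual code `C^⊥` is the `(α + uβ)⁻¹`-constacyclic code given
by the ideal `Σ_j ε̂_j·⟨f_j(x⁻¹)^{2p^s − i_j}⟩` of `𝓡̂ = R[x]/⟨x^{np^s} - (α + uβ)⁻¹⟩`,
where `x⁻¹ = (α + uβ)x^{np^s−1}` in `𝓡̂`, `f_j(x⁻¹)` is `f_j` evaluated at this element,
and `ε̂_j = τ(ε_j)` is the image of `ε_j` under the substitution `x ↦ x⁻¹`. -/
theorem stmt_19 (p m n s : ℕ) (hp : p.Prime) (hm : 0 < m) (hn : 0 < n) (hs : 0 < s)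
    (hnp : Nat.gcd n p = 1)
    (F : Type) [Field F] [Fintype F] (hF : Fintype.card F = p ^ m)
    (α β α₀ : F) (hα : α ≠ 0) (hβ : β ≠ 0) (hα₀ : α₀ ^ p ^ s = α)
    (hred : ¬ Irreducible ((X : F[X]) ^ n - C α₀))
    (r : ℕ) (f : Fin r → F[X])
    (hmon : ∀ j, (f j).Monic) (hirrf : ∀ j, Irreducible (f j))
    (hdist : ∀ j l, j ≠ l → f j ≠ f l)
    (hffac : ∏ j, f j = (X : F[X]) ^ n - C α₀)
    (g : Fin r → F[X]) (h : Fin r → (DualNumber F)[X])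
    (hh : ∀ j, h j = ((f j).map (algebraMap F (DualNumber F))) ^ p ^ s +
      C DualNumber.eps * (g j).map (algebraMap F (DualNumber F)))
    (hcop : ∀ j l, j ≠ l → IsCoprime (h j) (h l))
    (hfac : ∏ j, h j = (X : (DualNumber F)[X]) ^ (n * p ^ s) - C (lamAdd F α β))
    (sf tf : Fin r → (DualNumber F)[X])
    (hst : ∀ j, sf j * ∏ l ∈ Finset.univ.erase j, h l + tf j * h j = 1)
    (ε : Fin r → Amb F (n * p ^ s) (lamAdd F α β))
    (hε : ∀ j, ε j = ambMk F (n * p ^ s) (lamAdd F α β)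
      (sf j * ∏ l ∈ Finset.univ.erase j, h l))
    (y : Amb F (n * p ^ s) (lamInv F α β))
    (hy : y = ambMk F (n * p ^ s) (lamInv F α β)
      (C (lamAdd F α β) * X ^ (n * p ^ s - 1)))
    (εhat : Fin r → Amb F (n * p ^ s) (lamInv F α β))
    (hεhat : ∀ j, εhat j = Polynomial.aeval y (sf j * ∏ l ∈ Finset.univ.erase j, h l))
    (i : Fin r → ℕ) (hi : ∀ j, i j ≤ 2 * p ^ s) :
    dualCode (codeOf F (n * p ^ s) (lamAdd F α β)
        (∑ j, Ideal.span {ε j * ambMk F (n * p ^ s) (lamAdd F α β)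
          (((f j).map (algebraMap F (DualNumber F))) ^ i j)})) =
      codeOf F (n * p ^ s) (lamInv F α β)
        (∑ j, Ideal.span {εhat j *
          (Polynomial.aeval y ((f j).map (algebraMap F (DualNumber F)))) ^
            (2 * p ^ s - i j)}) := by
  have hP : p ^ s ≠ 0 := pow_ne_zero _ hp.ne_zero
  have hN : n * p ^ s ≠ 0 := mul_ne_zero hn.ne' hP
  have hl := lamAdd_mul_lamInv β hα
  have hl' : lamInv F α β * lamAdd F α β = 1 := by rw [mul_comm, hl]
  have hmk : ∀ q : (DualNumber F)[X], ∏ j, h j ∣ q → ambMk F (n * p ^ s) (lamAdd F α β) q = 0 :=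
    fun q hq => AdjoinRoot.mk_eq_zero.2 (hfac ▸ hq)
  have hprod : ∀ j, h j * ∏ l ∈ Finset.univ.erase j, h l = ∏ l, h l := fun j =>
    Finset.mul_prod_erase _ _ (Finset.mem_univ j)
  have hsum : ∑ j, ε j = 1 := by
    have := hmk _ (prod_dvd_sum_erase_sub_one hcop hst)
    rw [map_sub, map_sum, map_one, sub_eq_zero] at this
    rw [← this, Finset.sum_congr rfl fun j _ => hε j]
  have hort : ∀ j l, j ≠ l → ε j * ε l = 0 := fun j l hjl => by
    rw [hε, hε, ← map_mul]
    exact hmk _ (prod_dvd_erase_mul_erase hjl)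
  have hker : ∀ j q, h j ∣ q → ε j * ambMk F (n * p ^ s) (lamAdd F α β) q = 0 := fun j q hq => by
    rw [hε, ← map_mul]
    refine hmk _ ?_
    rw [← hprod j, mul_comm (h j)]
    exact mul_dvd_mul ⟨sf j, by ring⟩ hq
  have hfg : ∀ j, IsCoprime (f j) (g j) := fun j =>
    DualNumber.isCoprime_of_dvd hP hβ hα₀ (hirrf j)
      (hffac ▸ Finset.dvd_prod_of_mem f (Finset.mem_univ j))
      (hh j ▸ hfac ▸ Finset.dvd_prod_of_mem h (Finset.mem_univ j))
  have hdd : ∀ j, ε j * (ambMk F (n * p ^ s) (lamAdd F α β)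
        (((f j).map (algebraMap F (DualNumber F))) ^ i j) *
      ambMk F (n * p ^ s) (lamAdd F α β)
        (((f j).map (algebraMap F (DualNumber F))) ^ (2 * p ^ s - i j))) = 0 := fun j => by
    rw [← map_mul, ← pow_add, Nat.add_sub_cancel' (hi j)]
    exact hker j _ (hh j ▸ DualNumber.dvd_pow_two_mul _ _ _)
  have hann : ∀ j z, z * (ε j * ambMk F (n * p ^ s) (lamAdd F α β)
        (((f j).map (algebraMap F (DualNumber F))) ^ i j)) = 0 →
      ∃ c, ε j * z = c * (ε j * ambMk F (n * p ^ s) (lamAdd F α β)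
        (((f j).map (algebraMap F (DualNumber F))) ^ (2 * p ^ s - i j))) := fun j z hz => by
    obtain ⟨a, rfl⟩ := AdjoinRoot.mk_surjective z
    rw [hε, ← map_mul, ← map_mul, AdjoinRoot.mk_eq_zero, ← hfac] at hz
    have ha : h j ∣ a * ((f j).map (algebraMap F (DualNumber F))) ^ i j := by
      have hz' := (Finset.dvd_prod_of_mem h (Finset.mem_univ j)).trans hz
      obtain ⟨b, hb⟩ := hz'
      exact ⟨b + a * ((f j).map (algebraMap F (DualNumber F))) ^ i j * tf j, by
        linear_combination hb - a * ((f j).map (algebraMap F (DualNumber F))) ^ i j * hst j⟩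
    obtain ⟨k, hk⟩ := Nat.exists_eq_succ_of_ne_zero hP
    have hij := hi j
    rw [hh, hk] at ha
    rw [hk] at hij
    obtain ⟨c, hc⟩ := DualNumber.exists_dvd_sub_of_dvd_mul_pow (hirrf j).ne_zero (hfg j) k hij ha
    rw [← Nat.succ_eq_add_one, ← hk, ← hh] at hc
    have := hker j _ hc
    rw [map_sub, map_mul] at this
    exact ⟨ambMk F (n * p ^ s) (lamAdd F α β) c, by linear_combination this⟩
  have hsplit := forall_mul_eq_zero_iff_exists_sum hsum hort hdd hann
  have hhat : ∀ j, εhat j * (aeval y ((f j).map (algebraMap F (DualNumber F)))) ^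
      (2 * p ^ s - i j) = inversion hN hl (ε j * ambMk F (n * p ^ s) (lamAdd F α β)
        (((f j).map (algebraMap F (DualNumber F))) ^ (2 * p ^ s - i j))) := fun j => by
    rw [hεhat, hy, hε, map_mul (inversion hN hl), inversion_mk, inversion_mk, map_pow]
  ext a
  refine (mem_dualCode_iff hN hl _ a).trans ?_
  rw [codeOf, Set.mem_ofPred_eq]
  simp only [hhat, Ideal.mem_sum_span_singleton]
  obtain ⟨z, hz⟩ : ∃ z, inversion hN hl z = ambMk F (n * p ^ s) (lamInv F α β) (toPoly a) :=
    ⟨_, inversion_inversion hN hl hl' _⟩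
  rw [← hz]
  have hinj : Function.Injective (inversion hN hl) :=
    Function.LeftInverse.injective (inversion_inversion hN hl' hl)
  constructor
  · intro H
    obtain ⟨c, hc⟩ := (hsplit z).1 fun j => hinj <| by
      rw [map_mul, map_zero]
      exact H _ ⟨Pi.single j 1, by simp [Pi.single_apply]⟩
    exact ⟨fun j => inversion hN hl (c j), by rw [← hc, map_sum]; simp only [map_mul]⟩
  · rintro ⟨c, hc⟩ _ ⟨d, rfl⟩
    have hz' := (hsplit z).2 ⟨fun j => inversion hN hl' (c j), hinj <| by
      rw [← hc, map_sum]
      simp only [map_mul, inversion_inversion]⟩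
    rw [← map_mul, Finset.mul_sum, Finset.sum_eq_zero, map_zero]
    intro j _
    rw [mul_left_comm, hz', mul_zero]
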